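/- There is no unital C*-algebra A for which there exists a unital linear bijection γ : A → S₀ such that both γ and γ⁻¹ are completely positive. In other words, the operator system S₀ is not unitally completely order isomorphic to any unital C*-algebra. -/

import Mathlib

noncomputable section

open scoped ComplexOrder InnerProductSpace

/-- The Hilbert space ℓ²(ℕ) of square-summable complex sequences. -/
abbrev Hs : Type := lp (fun _ : ℕ => ℂ) 2

/-- The standard orthonormal basis vectors of ℓ²(ℕ) (indexed from 0). -/
def e (i : ℕ) : Hs := lp.single 2 i 1

/-- The matrix unit `E i j : x ↦ ⟨x, e j⟩ e i`. -/
def E (i j : ℕ) : Hs →L[ℂ] Hs := (innerSL ℂ (e j)).smulRight (e i)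

/-- `K₀`: the norm-closed linear span of the matrix units `E i j`, `(i,j) ≠ (0,0)`. -/
def K0 : Submodule ℂ (Hs →L[ℂ] Hs) :=
  (Submodule.span ℂ {T | ∃ i j : ℕ, (i, j) ≠ (0, 0) ∧ T = E i j}).topologicalClosure

/-- The operator system `S₀` spanned by `K₀` and the identity operator. -/
def S0 : Submodule ℂ (Hs →L[ℂ] Hs) := Submodule.span ℂ {(1 : Hs →L[ℂ] Hs)} ⊔ K0

lemma one_mem_S0 : (1 : Hs →L[ℂ] Hs) ∈ S0 :=
  Submodule.mem_sup_left (Submodule.mem_span_singleton_self _)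

/-- The matrix entry `X_{ij} = ⟨X e_j, e_i⟩` of a bounded operator on ℓ²(ℕ). -/
def entry (X : Hs →L[ℂ] Hs) (i j : ℕ) : ℂ := ⟪e i, X (e j)⟫_ℂ

/-- `φ_{n+1}(X) = V_{n+1}* X V_{n+1}`, the upper-left (n+1)×(n+1) corner of `X`. -/
def phi (n : ℕ) (X : Hs →L[ℂ] Hs) : Matrix (Fin (n+1)) (Fin (n+1)) ℂ :=
  fun i j => entry X i j

/-- `Q_{n+1}`: the projection onto the orthocomplement of the span of `e 0, …, e n`. -/
def Qop (n : ℕ) : Hs →L[ℂ] Hs := 1 - ∑ i : Fin (n+1), E i i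

/-- `ψ_{n+1}(Y) = V_{n+1} Y V_{n+1}* + y₀₀ Q_{n+1}`. -/
def psi (n : ℕ) (Y : Matrix (Fin (n+1)) (Fin (n+1)) ℂ) : Hs →L[ℂ] Hs :=
  (∑ i : Fin (n+1), ∑ j : Fin (n+1), Y i j • E i j) + Y 0 0 • Qop n

/-- Positivity in the C*-algebra of m×m matrices over a star ring: `M = N* N`. -/
def MatPos {A : Type*} [Ring A] [StarRing A] {m : ℕ}
    (M : Matrix (Fin m) (Fin m) A) : Prop :=
  ∃ N : Matrix (Fin m) (Fin m) A, M = N.conjTranspose * N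

/-- Complete positivity of a map between star rings: every matrix amplification
preserves positivity. -/
def IsCPfun {A B : Type*} [Ring A] [StarRing A] [Ring B] [StarRing B]
    (θ : A → B) : Prop :=
  ∀ (m : ℕ) (M : Matrix (Fin m) (Fin m) A), MatPos M → MatPos (M.map θ)

lemma e_norm (i : ℕ) : ⟪e i, e i⟫_ℂ = 1 := by
  simp [e, lp.inner_single_left]

lemma e_nrm (i : ℕ) : ‖e i‖ = 1 := by
  simp [e]

lemma e_inner (i j : ℕ) : ⟪e i, e j⟫_ℂ = if i = j then 1 else 0 := by
  unfold e
  rw [lp.inner_single_left]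
  by_cases h : i = j
  · subst h; simp
  · simp [h, lp.single_apply, Pi.single_apply]

lemma E_apply (i j : ℕ) (x : Hs) : E i j x = ⟪e j, x⟫_ℂ • e i := by
  simp [E]

lemma E_star (i j : ℕ) : star (E i j) = E j i := by
  rw [ContinuousLinearMap.star_eq_adjoint]
  symm
  rw [ContinuousLinearMap.eq_adjoint_iff]
  intro x y
  simp only [E_apply, inner_smul_left, inner_smul_right, inner_conj_symm]
  ring

lemma E_mul (i j k l : ℕ) : E i j * E k l = if j = k then E i l else 0 := by
  ext1 x
  by_cases h : j = k
  · simp [E_apply, e_inner, e_nrm, h]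
  · simp [E_apply, e_inner, e_nrm, h]

lemma E_mem_S0 (i j : ℕ) (h : (i, j) ≠ (0, 0)) : E i j ∈ S0 :=
  Submodule.mem_sup_right (Submodule.le_topologicalClosure _ (Submodule.subset_span ⟨i, j, h, rfl⟩))

lemma entry_E (k l i j : ℕ) : entry (E k l) i j = if i = k ∧ j = l then 1 else 0 := by
  unfold entry
  rw [E_apply, inner_smul_right, e_inner, e_inner]
  by_cases h : i = k <;> by_cases h' : j = l <;> simp [h, h', eq_comm (a := l)]

lemma span_diag (Y : Hs →L[ℂ] Hs)
    (hY : Y ∈ Submodule.span ℂ {T | ∃ i j : ℕ, (i, j) ≠ (0, 0) ∧ T = E i j}) :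
    entry Y 0 0 = 0 ∧ ∃ n, ∀ i ≥ n, entry Y i i = 0 := by
  induction hY using Submodule.span_induction with
  | mem x hx =>
    obtain ⟨i, j, hij, rfl⟩ := hx
    constructor
    · rw [entry_E, if_neg]
      rintro ⟨rfl, rfl⟩
      exact hij rfl
    · refine ⟨i + 1, fun k hk => ?_⟩
      rw [entry_E, if_neg]
      rintro ⟨h, -⟩
      omega
  | zero => simp [entry]
  | add x y _ _ hx hy =>
    obtain ⟨hx0, n, hn⟩ := hx
    obtain ⟨hy0, m, hm⟩ := hy
    have hadd : ∀ i, entry (x + y) i i = entry x i i + entry y i i := by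
      intro i; simp [entry, inner_add_right]
    refine ⟨by rw [hadd, hx0, hy0, add_zero], max n m, fun i hi => ?_⟩
    rw [hadd, hn i (le_trans (le_max_left _ _) hi), hm i (le_trans (le_max_right _ _) hi), add_zero]
  | smul a x _ hx =>
    obtain ⟨hx0, n, hn⟩ := hx
    have hs : ∀ i, entry (a • x) i i = a * entry x i i := by
      intro i; simp [entry, inner_smul_right]
    refine ⟨by rw [hs, hx0, mul_zero], n, fun i hi => ?_⟩
    rw [hs, hn i hi, mul_zero]

lemma entry_bound (X : Hs →L[ℂ] Hs) (i : ℕ) : ‖entry X i i‖ ≤ ‖X‖ := by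
  unfold entry
  calc _ ≤ ‖e i‖ * ‖X (e i)‖ := norm_inner_le_norm _ _
    _ ≤ ‖e i‖ * (‖X‖ * ‖e i‖) := by gcongr; exact X.le_opNorm _
    _ = ‖X‖ := by rw [e_nrm]; ring

lemma entry_sub (X Y : Hs →L[ℂ] Hs) (i : ℕ) : entry (X - Y) i i = entry X i i - entry Y i i := by
  simp [entry, inner_sub_right]

lemma S0_diag (X : Hs →L[ℂ] Hs) (hX : X ∈ S0) :
    ∃ i, 1 ≤ i ∧ ‖entry X i i - entry X 0 0‖ < 1 := by
  obtain ⟨a, ha, K, hK, rfl⟩ := Submodule.mem_sup.1 hX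
  obtain ⟨c, rfl⟩ := Submodule.mem_span_singleton.1 ha
  have hK' : K ∈ closure ((Submodule.span ℂ {T | ∃ i j : ℕ, (i, j) ≠ (0, 0) ∧ T = E i j} :
      Submodule ℂ (Hs →L[ℂ] Hs)) : Set (Hs →L[ℂ] Hs)) := hK
  obtain ⟨Y, hY, hd⟩ := Metric.mem_closure_iff.1 hK' (1/2) (by norm_num)
  rw [dist_eq_norm] at hd
  obtain ⟨h0, n, hn⟩ := span_diag Y hY
  refine ⟨n + 1, by omega, ?_⟩
  have hc : ∀ i, entry (c • (1 : Hs →L[ℂ] Hs) + K) i i = c + entry (K - Y) i i + entry Y i i := by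
    intro i
    rw [entry_sub]
    simp [entry, inner_add_right, e_nrm]
    ring
  rw [hc, hc, h0, hn (n+1) (by omega)]
  have b1 := entry_bound (K - Y) (n+1)
  have b2 := entry_bound (K - Y) 0
  have : c + entry (K - Y) (n+1) (n+1) + 0 - (c + entry (K - Y) 0 0 + 0)
    = entry (K - Y) (n+1) (n+1) - entry (K - Y) 0 0 := by ring
  rw [this]
  have := norm_sub_le (entry (K - Y) (n+1) (n+1)) (entry (K - Y) 0 0)
  linarith

lemma matpos_form (M : Matrix (Fin 2) (Fin 2) (Hs →L[ℂ] Hs)) (h : MatPos M) (x y : Hs) :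
    0 ≤ (⟪x, M 0 0 x⟫_ℂ + ⟪x, M 0 1 y⟫_ℂ + ⟪y, M 1 0 x⟫_ℂ + ⟪y, M 1 1 y⟫_ℂ).re := by
  obtain ⟨N, rfl⟩ := h
  have key : ∀ k, 0 ≤ (⟪N k 0 x + N k 1 y, N k 0 x + N k 1 y⟫_ℂ).re := fun k =>
    inner_self_nonneg (𝕜 := ℂ)
  have h0 := key 0
  have h1 := key 1
  simp only [inner_add_left, inner_add_right, Complex.add_re] at h0 h1
  simp only [Matrix.mul_apply, Fin.sum_univ_two, Matrix.conjTranspose_apply,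
    ContinuousLinearMap.star_eq_adjoint, ContinuousLinearMap.add_apply,
    ContinuousLinearMap.mul_apply, inner_add_right, ContinuousLinearMap.adjoint_inner_right,
    Complex.add_re]
  linarith

/-- there is no unital C*-algebra `A` admitting a unital linear bijection
`γ : A → S₀` such that `γ` and `γ⁻¹` are both completely positive; i.e. `S₀` is not
unitally completely order isomorphic to any unital C*-algebra. -/
theorem stmt_4 (A : Type*) [CStarAlgebra A]
    (γ : A ≃ₗ[ℂ] ↥S0) (h1 : γ 1 = ⟨1, one_mem_S0⟩)
    (hcp : ∀ (m : ℕ) (M : Matrix (Fin m) (Fin m) A), MatPos M →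
      MatPos ((M.map γ).map (fun x => (x : Hs →L[ℂ] Hs))))
    (hcpinv : ∀ (m : ℕ) (M : Matrix (Fin m) (Fin m) ↥S0),
      MatPos (M.map (fun x => (x : Hs →L[ℂ] Hs))) → MatPos (M.map γ.symm)) :
    False := by
  let v : A := γ.symm ⟨E 0 1, E_mem_S0 0 1 (by simp)⟩
  have hv : γ v = ⟨E 0 1, E_mem_S0 0 1 (by simp)⟩ := γ.apply_symm_apply _
  let w : A := γ.symm ⟨E 1 0, E_mem_S0 1 0 (by simp)⟩
  have hw : γ w = ⟨E 1 0, E_mem_S0 1 0 (by simp)⟩ := γ.apply_symm_apply _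
  have h1' : γ.symm ⟨1, one_mem_S0⟩ = 1 := by rw [← h1, γ.symm_apply_apply]
  -- the key positivity in A
  have keyA : ∀ i, 1 ≤ i → ∀ hi : E i i ∈ S0,
      MatPos !![1 - γ.symm ⟨E i i, hi⟩, v; w, 1] := by
    intro i hi him
    have := hcpinv 2 !![⟨1, one_mem_S0⟩ - ⟨E i i, him⟩, ⟨E 0 1, E_mem_S0 0 1 (by simp)⟩;
      ⟨E 1 0, E_mem_S0 1 0 (by simp)⟩, ⟨1, one_mem_S0⟩] ?_
    · convert this using 1
      ext a b
      fin_cases a <;> fin_cases b <;> simp [h1', v, w]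
    · refine ⟨!![1 - E i i - E 0 0, 0; E 1 0, 1], ?_⟩
      have hi0 : i ≠ 0 := by omega
      ext1 a b
      fin_cases a <;> fin_cases b <;>
        simp [Matrix.mul_apply, Fin.sum_univ_two, E_star, E_mul, mul_sub, sub_mul, hi0, hi0.symm]
  have hE : ∀ i, 1 ≤ i → E i i ∈ S0 := fun i hi => E_mem_S0 i i (by simp; omega)
  have hwv : w = star v := by
    obtain ⟨N, hN⟩ := keyA 1 le_rfl (hE 1 le_rfl)
    have hs : star (N.conjTranspose * N) = N.conjTranspose * N := by
      simp [Matrix.star_eq_conjTranspose]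
    rw [← hN] at hs
    have := congrFun (congrFun hs 1) 0
    simpa [Matrix.star_apply] using this.symm
  set q : A := v * star v with hq
  have hq0 : 1 ≤ (entry (γ q : Hs →L[ℂ] Hs) 0 0).re := by
    have hp := hcp 2 !![q, v; w, 1] ⟨!![0, 0; w, 1], by
      ext1 a b
      fin_cases a <;> fin_cases b <;>
        simp [Matrix.mul_apply, Fin.sum_univ_two, hwv, hq]⟩
    have := matpos_form _ hp (e 0) (-e 1)
    simp [hv, hw, h1, E_apply, e_inner, e_nrm, inner_neg_left] at this
    unfold entry
    linarith
  have hqi : ∀ i, 1 ≤ i → (entry (γ q : Hs →L[ℂ] Hs) i i).re ≤ 0 := by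
    intro i hi
    obtain ⟨N, hN⟩ := keyA i hi (hE i hi)
    have hp := hcp 2 !![1 - γ.symm ⟨E i i, hE i hi⟩ - q, 0; 0, 0]
      ⟨N * !![1, 0; -star v, 0], by
        rw [Matrix.conjTranspose_mul, Matrix.mul_assoc, ← Matrix.mul_assoc _ N, ← hN]
        ext1 a b
        fin_cases a <;> fin_cases b <;>
          simp [Matrix.mul_apply, Fin.sum_univ_two, hwv, hq, sub_eq_add_neg]⟩
    have := matpos_form _ hp (e i) 0
    simp [h1, E_apply, e_inner, e_nrm, inner_sub_right] at this
    unfold entry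
    linarith
  obtain ⟨i, hi, hlt⟩ := S0_diag (γ q) (γ q).2
  have h2 := hqi i hi
  have h3 := (Complex.abs_re_le_norm _).trans_lt hlt
  rw [Complex.sub_re, abs_lt] at h3
  linarith
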